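/- arXiv:2010.13927 — 3 statements merged into one kernel-verified Lean document; each statement's English description precedes it below -/
import Mathlib

section
/- Let 0 < p < 1 and define f : ℝ^n → ℝ by f(x) = ∑_{i=1}^n |x_i|^p (the ℓ_p quasi-norm raised to the power p). For every x̄ ∈ ℝ^n, a vector u ∈ ℝ^n is a regular subgradient of f at x̄ if and only if u_i = p·sign(x̄_i)·|x̄_i|^{p−1} for every index i with x̄_i ≠ 0 (the coordinates u_i with x̄_i = 0 are unconstrained). -/
open Filter Topology

/-- `u` is a regular subgradient of `f : ℝ^N → ℝ` at `x̄` if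
`liminf_{x → x̄, x ≠ x̄} (f(x) − f(x̄) − ⟨u, x − x̄⟩)/‖x − x̄‖₂ ≥ 0`. -/
def IsRegularSubgradient {N : ℕ} (f : (Fin N → ℝ) → ℝ) (xb u : Fin N → ℝ) : Prop :=
  0 ≤ Filter.liminf
    (fun x : Fin N → ℝ =>
      (((f x - f xb - ∑ i, u i * (x i - xb i)) /
          Real.sqrt (∑ i, (x i - xb i) ^ 2) : ℝ) : EReal))
    (𝓝[≠] xb)

theorem isRegularSubgradient_iff {N : ℕ} (f : (Fin N → ℝ) → ℝ) (xb u : Fin N → ℝ) :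
    IsRegularSubgradient f xb u ↔ ∀ ε > 0, ∀ᶠ x in 𝓝 xb,
      -ε * Real.sqrt (∑ i, (x i - xb i) ^ 2) ≤ f x - f xb - ∑ i, u i * (x i - xb i) := by
  have hpos : ∀ x, x ≠ xb → 0 < Real.sqrt (∑ i, (x i - xb i) ^ 2) := by
    intro x hx
    obtain ⟨i, hi⟩ := Function.ne_iff.1 hx
    refine Real.sqrt_pos.2 (Finset.sum_pos' (fun j _ => sq_nonneg _) ⟨i, Finset.mem_univ i, ?_⟩)
    have : x i - xb i ≠ 0 := sub_ne_zero.2 hi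
    positivity
  unfold IsRegularSubgradient
  rw [Filter.le_liminf_iff]
  constructor
  · intro h ε hε
    have h₁ := h ((-ε : ℝ) : EReal) (by exact_mod_cast neg_lt_zero.2 hε)
    rw [eventually_nhdsWithin_iff] at h₁
    filter_upwards [h₁] with x hx
    by_cases hxb : x = xb
    · simp [hxb]
    · have h₂ := EReal.coe_lt_coe_iff.1 (hx hxb)
      exact ((lt_div_iff₀ (hpos x hxb)).1 h₂).le
  · intro h y hy
    obtain ⟨c, hyc, hc⟩ := EReal.lt_iff_exists_real_btwn.1 hy
    have hc' : c < 0 := by exact_mod_cast hc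
    rw [eventually_nhdsWithin_iff]
    filter_upwards [h (-c) (by linarith)] with x hx hxb
    refine hyc.trans_le (EReal.coe_le_coe_iff.2 ?_)
    rw [le_div_iff₀ (hpos x hxb)]
    simpa using hx

theorem hasDerivAt_abs_rpow_const (p : ℝ) {a : ℝ} (ha : a ≠ 0) :
    HasDerivAt (fun t : ℝ => |t| ^ p) (p * Real.sign a * |a| ^ (p - 1)) a := by
  have h := (hasDerivAt_abs ha).rpow_const (p := p) (Or.inl (abs_ne_zero.2 ha))
  convert h using 1
  rcases ha.lt_or_gt with h | h
  · simp [Real.sign_of_neg h, sign_neg h]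
  · simp [Real.sign_of_pos h, sign_pos h]

theorem HasDerivAt.eventually_abs_sub_le {g : ℝ → ℝ} {d a : ℝ} (hg : HasDerivAt g d a)
    {ε : ℝ} (hε : 0 < ε) :
    ∀ᶠ t in 𝓝 a, |g t - g a - d * (t - a)| ≤ ε * |t - a| := by
  have h := (hasDerivAt_iff_isLittleO.1 hg).def hε
  filter_upwards [h] with t ht
  simpa [mul_comm] using ht

theorem HasDerivAt.eq_of_eventually_le {g : ℝ → ℝ} {d a u : ℝ} (hg : HasDerivAt g d a)
    (h : ∀ ε > 0, ∀ᶠ t in 𝓝 a, -ε * |t - a| ≤ g t - g a - u * (t - a)) : u = d := by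
  refine eq_of_abs_sub_le_all fun ε hε => ?_
  obtain ⟨δ, hδ, hball⟩ := Metric.eventually_nhds_iff.1
    ((h (ε / 2) (half_pos hε)).and (hg.eventually_abs_sub_le (half_pos hε)))
  have key : ∀ s, |s| = δ / 2 → (u - d) * s ≤ ε * (δ / 2) := by
    intro s hs
    obtain ⟨h₁, h₂⟩ := hball (y := a + s) (by simp [hs]; linarith)
    rw [add_sub_cancel_left, hs] at h₁ h₂
    linarith [le_abs_self (g (a + s) - g a - d * s)]
  have hδ₂ : 0 < δ / 2 := half_pos hδ
  have h₁ := key (δ / 2) (abs_of_pos hδ₂)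
  have h₂ := key (-(δ / 2)) (by rw [abs_neg, abs_of_pos hδ₂])
  rw [abs_le]
  constructor
  · exact le_of_mul_le_mul_right (by linarith) hδ₂
  · exact le_of_mul_le_mul_right h₁ hδ₂

theorem eventually_mul_le_abs_rpow {p : ℝ} (hp : p < 1) (u : ℝ) :
    ∀ᶠ t : ℝ in 𝓝 0, u * t ≤ |t| ^ p := by
  have hlim : Tendsto (fun t : ℝ => |u| * |t| ^ (1 - p)) (𝓝 0) (𝓝 0) := by
    have hc : Continuous fun t : ℝ => |u| * |t| ^ (1 - p) :=
      continuous_const.mul (continuous_abs.rpow_const fun _ => Or.inr (by linarith))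
    have := hc.tendsto 0
    simpa [Real.zero_rpow (by linarith : 1 - p ≠ 0)] using this
  filter_upwards [hlim.eventually_le_const one_pos] with t ht
  rcases eq_or_ne t 0 with rfl | h₀
  · simpa using Real.rpow_nonneg le_rfl p
  · have hsplit : |t| = |t| ^ (1 - p) * |t| ^ p := by
      rw [← Real.rpow_add (abs_pos.2 h₀)]; simp
    calc u * t ≤ |u| * |t| := by rw [← abs_mul]; exact le_abs_self _
      _ = |u| * |t| ^ (1 - p) * |t| ^ p := by rw [mul_assoc, ← hsplit]
      _ ≤ 1 * |t| ^ p := by gcongr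
      _ = |t| ^ p := one_mul _

/-- Regular subgradients of a separable sum are characterised coordinatewise. -/
theorem isRegularSubgradient_sum_iff {N : ℕ} (g : ℝ → ℝ) (xb u : Fin N → ℝ) :
    IsRegularSubgradient (fun x => ∑ i, g (x i)) xb u ↔ ∀ i, ∀ ε > 0,
      ∀ᶠ t in 𝓝 (xb i), -ε * |t - xb i| ≤ g t - g (xb i) - u i * (t - xb i) := by
  rw [isRegularSubgradient_iff]
  constructor
  · intro h i ε hε
    have hcont : Tendsto (fun t => Function.update xb i t) (𝓝 (xb i)) (𝓝 xb) := by
      have := (continuous_const.update i continuous_id :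
        Continuous fun t => Function.update xb i t).tendsto (xb i)
      simpa using this
    filter_upwards [hcont.eventually (h ε hε)] with t ht
    have single : ∀ F : Fin N → ℝ → ℝ, (∀ j, F j (xb j) = 0) →
        ∑ j, F j (Function.update xb i t j) = F i t := by
      intro F hF
      rw [Finset.sum_eq_single i (fun j _ hj => by simp [hj, hF]) (by simp)]
      simp
    rw [← Finset.sum_sub_distrib, single (fun j s => (s - xb j) ^ 2) (by simp),
      single (fun j s => u j * (s - xb j)) (by simp),
      single (fun j s => g s - g (xb j)) (by simp), Real.sqrt_sq_eq_abs] at ht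
    exact ht
  · intro h ε hε
    have hN : (0 : ℝ) < N + 1 := by positivity
    have hev : ∀ᶠ x in 𝓝 xb, ∀ i, -(ε / (N + 1)) * |x i - xb i| ≤
        g (x i) - g (xb i) - u i * (x i - xb i) :=
      eventually_all.2 fun i =>
        (continuous_apply i).continuousAt.eventually (h i (ε / (N + 1)) (div_pos hε hN))
    filter_upwards [hev] with x hx
    rw [← Finset.sum_sub_distrib, ← Finset.sum_sub_distrib]
    set r := Real.sqrt (∑ i, (x i - xb i) ^ 2)
    have hr : 0 ≤ r := Real.sqrt_nonneg _
    have hle : ∀ i, |x i - xb i| ≤ r := fun i =>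
      Real.abs_le_sqrt (Finset.single_le_sum (f := fun j => (x j - xb j) ^ 2)
        (fun j _ => sq_nonneg _) (Finset.mem_univ i))
    calc -ε * r = (N + 1) * (-(ε / (N + 1)) * r) := by field_simp
      _ ≤ N * (-(ε / (N + 1)) * r) := by
        have : 0 ≤ ε / (N + 1) * r := by positivity
        linarith
      _ = ∑ _i : Fin N, -(ε / (N + 1)) * r := by simp
      _ ≤ _ := Finset.sum_le_sum fun i _ => le_trans
        (mul_le_mul_of_nonpos_left (hle i) (neg_nonpos.2 (by positivity))) (hx i)

/-- For `f(x) = ∑ i |x_i|^p` with `0 < p < 1`, a vector `u` is a regular subgradient of `f`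
at `x̄` iff `u_i = p · sign(x̄_i) · |x̄_i|^{p−1}` for every `i` with `x̄_i ≠ 0` (coordinates with
`x̄_i = 0` are unconstrained). -/
theorem stmt_11 {n : ℕ} (p : ℝ) (hp0 : 0 < p) (hp1 : p < 1) (xb u : Fin n → ℝ) :
    IsRegularSubgradient (fun x => ∑ i, |x i| ^ p) xb u ↔
      ∀ i, xb i ≠ 0 → u i = p * Real.sign (xb i) * |xb i| ^ (p - 1) := by
  rw [isRegularSubgradient_sum_iff (fun t => |t| ^ p)]
  refine forall_congr' fun i => ⟨fun h hi => (hasDerivAt_abs_rpow_const p hi).eq_of_eventually_le h,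
    fun h ε hε => ?_⟩
  by_cases hi : xb i = 0
  · rw [hi]
    filter_upwards [eventually_mul_le_abs_rpow hp1 (u i)] with t ht
    have : 0 ≤ ε * |t| := by positivity
    simp only [sub_zero, abs_zero, Real.zero_rpow hp0.ne']
    linarith
  · rw [h hi]
    filter_upwards [(hasDerivAt_abs_rpow_const p hi).eventually_abs_sub_le hε] with t ht
    rw [neg_mul]
    exact (abs_le.1 ht).1
end

section
/- Let 0 < p < 1, σ > 0, λ > 0, and set μ = ((2−2p)/(2−p))·σ. Then there exists τ > 0 with −σ·τ² + (1/2)·τ⁴ + λ·τ^{2p} < 0 if and only if λ − μ^{1−p}·σ + (1/2)·μ^{2−p} < 0. -/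
/-- Weighted AM-GM: the minimum of `t ↦ t ^ (2 - p) / 2 - t ^ (1 - p) * s` over `t > 0`
is attained at the critical point `m`. -/
theorem rpow_critical_value_le {p s m t : ℝ} (hp1 : p < 1) (hm : 0 < m) (ht : 0 < t)
    (hms : (2 - p) * m = (2 - 2 * p) * s) :
    1 / 2 * m ^ (2 - p) - m ^ (1 - p) * s ≤ 1 / 2 * t ^ (2 - p) - t ^ (1 - p) * s := by
  have h2 : 0 < 2 - p := by linarith
  have h1 : 0 < 1 - p := by linarith
  have amgm := Real.geom_mean_le_arith_mean2_weighted (w₁ := (1 - p) / (2 - p))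
    (w₂ := 1 / (2 - p)) (p₁ := t ^ (2 - p)) (p₂ := m ^ (2 - p)) (by positivity)
    (by positivity) (by positivity) (by positivity) (by field_simp; ring)
  rw [← Real.rpow_mul ht.le, ← Real.rpow_mul hm.le, mul_div_cancel₀ _ h2.ne',
    mul_div_cancel₀ _ h2.ne', Real.rpow_one] at amgm
  have hB : m ^ (2 - p) = m ^ (1 - p) * m := by
    rw [show 2 - p = (1 - p) + 1 by ring, Real.rpow_add_one hm.ne']
  have amgm' : (2 - p) * (t ^ (1 - p) * m) ≤ (1 - p) * t ^ (2 - p) + m ^ (2 - p) := by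
    have := mul_le_mul_of_nonneg_left amgm h2.le
    have e : (2 - p) * ((1 - p) / (2 - p) * t ^ (2 - p) + 1 / (2 - p) * m ^ (2 - p)) =
        (1 - p) * t ^ (2 - p) + m ^ (2 - p) := by field_simp
    linarith
  have eT : (2 - p) * (t ^ (1 - p) * m) = 2 * (1 - p) * (t ^ (1 - p) * s) := by
    linear_combination t ^ (1 - p) * hms
  have eM : (2 - p) * m ^ (2 - p) = 2 * (1 - p) * (m ^ (1 - p) * s) := by
    rw [hB]; linear_combination m ^ (1 - p) * hms
  refine le_of_mul_le_mul_left ?_ h1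
  linarith

/-- The substitution `t = τ ^ 2` turns the quartic expression into `t ^ p` times a function
of `t`. -/
theorem quartic_eq_rpow_mul {p s l t : ℝ} (ht : 0 < t) :
    -s * t + 1 / 2 * t ^ 2 + l * t ^ p =
      t ^ p * (l - t ^ (1 - p) * s + 1 / 2 * t ^ (2 - p)) := by
  have e1 : t ^ p * t ^ (1 - p) = t := by
    rw [← Real.rpow_add ht, add_sub_cancel, Real.rpow_one]
  have e2 : t ^ p * t ^ (2 - p) = t ^ 2 := by
    rw [← Real.rpow_add ht, add_sub_cancel, Real.rpow_two]
  linear_combination s * e1 - 1 / 2 * e2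

/-- For `0 < p < 1`, `σ > 0`, `λ > 0` and `μ = ((2−2p)/(2−p))σ`, there exists `τ > 0` with
`−σ τ² + (1/2) τ⁴ + λ τ^{2p} < 0` iff `λ − μ^{1−p} σ + (1/2) μ^{2−p} < 0`. -/
theorem stmt_15 (p sig lam : ℝ) (hp0 : 0 < p) (hp1 : p < 1) (hsig : 0 < sig)
    (hlam : 0 < lam) :
    (∃ τ : ℝ, 0 < τ ∧
        -sig * τ ^ (2 : ℕ) + (1 / 2) * τ ^ (4 : ℕ) + lam * τ ^ (2 * p) < 0) ↔
      lam - ((2 - 2 * p) / (2 - p) * sig) ^ (1 - p) * sig +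
          (1 / 2) * ((2 - 2 * p) / (2 - p) * sig) ^ (2 - p) < 0 := by
  have h2 : 0 < 2 - p := by linarith
  have hm : 0 < (2 - 2 * p) / (2 - p) * sig :=
    mul_pos (div_pos (by linarith) h2) hsig
  have hms : (2 - p) * ((2 - 2 * p) / (2 - p) * sig) = (2 - 2 * p) * sig := by
    field_simp
  generalize (2 - 2 * p) / (2 - p) * sig = m at hm hms ⊢
  have key : ∀ τ : ℝ, 0 < τ →
      -sig * τ ^ (2 : ℕ) + (1 / 2) * τ ^ (4 : ℕ) + lam * τ ^ (2 * p) =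
        (τ ^ 2) ^ p * (lam - (τ ^ 2) ^ (1 - p) * sig + 1 / 2 * (τ ^ 2) ^ (2 - p)) := by
    intro τ hτ
    rw [← quartic_eq_rpow_mul (pow_pos hτ 2), Real.rpow_mul hτ.le, Real.rpow_two]
    ring
  constructor
  · rintro ⟨τ, hτ, h⟩
    rw [key τ hτ] at h
    have hneg := neg_of_mul_neg_right h (by positivity)
    linarith [rpow_critical_value_le hp1 hm (pow_pos hτ 2) hms]
  · intro h
    refine ⟨√m, Real.sqrt_pos.2 hm, ?_⟩
    rw [key _ (Real.sqrt_pos.2 hm), Real.sq_sqrt hm.le]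
    exact mul_neg_of_pos_of_neg (by positivity) h
end

section
/- Let 0 < p ≤ 1, λ > 0, let A : ℝ^{m×n} → ℝ^q be a linear map with adjoint A* (with respect to the Frobenius and Euclidean inner products), and let R ∈ ℝ^q. Then the infimum over ū ∈ ℝ^m, v̄ ∈ ℝ^n of (1/2)‖R − A(ūv̄ᵀ)‖₂² + λ((‖ū‖₂² + ‖v̄‖₂²)/2)^p equals (1/2)‖R‖₂² plus the infimum over τ ≥ 0 and unit vectors u ∈ ℝ^m, v ∈ ℝ^n (‖u‖₂ = ‖v‖₂ = 1) of −τ²⟨A*(R), uvᵀ⟩_F + (1/2)τ⁴‖A(uvᵀ)‖₂² + λτ^{2p}. -/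
open Matrix

theorem sInf_eq_add_sInf {S T : Set ℝ} {c : ℝ} (hS : BddBelow S) (hT : T.Nonempty)
    (hTS : ∀ t ∈ T, c + t ∈ S) (hST : ∀ s ∈ S, ∃ t ∈ T, c + t ≤ s) :
    sInf S = c + sInf T := by
  obtain ⟨b, hb⟩ := hS
  have hTb : BddBelow T := ⟨b - c, fun t ht => by linarith [hb (hTS t ht)]⟩
  apply le_antisymm
  · have h : sInf S - c ≤ sInf T :=
      le_csInf hT fun t ht => by linarith [csInf_le ⟨b, hb⟩ (hTS t ht)]
    linarith
  · refine le_csInf (hT.elim fun t ht => ⟨c + t, hTS t ht⟩) fun s hs => ?_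
    obtain ⟨t, ht, hts⟩ := hST s hs
    linarith [csInf_le hTb ht]

theorem exists_eq_smul_unit {ι : Type*} [Fintype ι] [Nonempty ι] (w : ι → ℝ) :
    ∃ (a : ℝ) (u : ι → ℝ), 0 ≤ a ∧ ∑ i, u i ^ 2 = 1 ∧ w = a • u := by
  classical
  have hw : 0 ≤ ∑ i, w i ^ 2 := Finset.sum_nonneg fun i _ => sq_nonneg (w i)
  rcases hw.eq_or_lt with h | h
  · refine ⟨0, Pi.single (Classical.arbitrary ι) 1, le_rfl, ?_, ?_⟩
    · simp [Pi.single_apply]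
    · ext i
      have := (Finset.sum_eq_zero_iff_of_nonneg fun i _ => sq_nonneg (w i)).1 h.symm i
        (Finset.mem_univ i)
      simpa using this
  · have ha := Real.sqrt_pos.2 h
    refine ⟨√(∑ i, w i ^ 2), (√(∑ i, w i ^ 2))⁻¹ • w, ha.le, ?_, ?_⟩
    · simp only [Pi.smul_apply, smul_eq_mul, mul_pow, ← Finset.mul_sum, inv_pow]
      rw [Real.sq_sqrt hw, inv_mul_cancel₀ h.ne']
    · rw [smul_smul, mul_inv_cancel₀ ha.ne', one_smul]

theorem sum_sq_smul {ι : Type*} [Fintype ι] (a : ℝ) (u : ι → ℝ) :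
    ∑ i, (a • u) i ^ 2 = a ^ 2 * ∑ i, u i ^ 2 := by
  simp only [Pi.smul_apply, smul_eq_mul, mul_pow, Finset.mul_sum]

theorem half_sum_sub_sq_rank_one {m n q : ℕ}
    (A : Matrix (Fin m) (Fin n) ℝ →ₗ[ℝ] (Fin q → ℝ))
    (Aad : (Fin q → ℝ) →ₗ[ℝ] Matrix (Fin m) (Fin n) ℝ)
    (hadj : ∀ (X : Matrix (Fin m) (Fin n) ℝ) (y : Fin q → ℝ),
      ∑ k, A X k * y k = ∑ i, ∑ j, X i j * Aad y i j)
    (R : Fin q → ℝ) (a b : ℝ) (u : Fin m → ℝ) (v : Fin n → ℝ) :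
    (1 / 2) * (∑ k, (R k - A (vecMulVec (a • u) (b • v)) k) ^ 2) =
      (1 / 2) * (∑ k, R k ^ 2) - a * b * (∑ i, ∑ j, Aad R i j * vecMulVec u v i j) +
        (1 / 2) * (a * b) ^ 2 * (∑ k, A (vecMulVec u v) k ^ 2) := by
  have hA : A (vecMulVec (a • u) (b • v)) = (a * b) • A (vecMulVec u v) := by
    rw [smul_vecMulVec, vecMulVec_smul, smul_smul, map_smul]
  have hR : ∑ i, ∑ j, Aad R i j * vecMulVec u v i j = ∑ k, A (vecMulVec u v) k * R k := by
    rw [hadj]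
    simp only [mul_comm]
  rw [hA, hR]
  simp only [Finset.mul_sum, ← Finset.sum_add_distrib, ← Finset.sum_sub_distrib, Pi.smul_apply,
    smul_eq_mul]
  exact Finset.sum_congr rfl fun k _ => by ring

/-- For a linear map `A` with adjoint `A*` (w.r.t. the Frobenius and Euclidean inner products),
the infimum over `(ū, v̄)` of `(1/2)‖R − A(ū v̄ᵀ)‖₂² + λ((‖ū‖₂² + ‖v̄‖₂²)/2)^p` equals
`(1/2)‖R‖₂²` plus the infimum over `τ ≥ 0` and unit vectors `u`, `v` of
`−τ² ⟨A*(R), u vᵀ⟩_F + (1/2) τ⁴ ‖A(u vᵀ)‖₂² + λ τ^{2p}`. -/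
theorem stmt_17 {m n q : ℕ} (p lam : ℝ) (hp0 : 0 < p) (hp1 : p ≤ 1) (hlam : 0 < lam)
    (A : Matrix (Fin m) (Fin n) ℝ →ₗ[ℝ] (Fin q → ℝ))
    (Aad : (Fin q → ℝ) →ₗ[ℝ] Matrix (Fin m) (Fin n) ℝ)
    (hadj : ∀ (X : Matrix (Fin m) (Fin n) ℝ) (y : Fin q → ℝ),
      ∑ k, A X k * y k = ∑ i, ∑ j, X i j * Aad y i j)
    (R : Fin q → ℝ) :
    sInf {z : ℝ | ∃ (ub : Fin m → ℝ) (vb : Fin n → ℝ),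
        z = (1 / 2) * (∑ k, (R k - A (vecMulVec ub vb) k) ^ 2) +
            lam * (((∑ i, ub i ^ 2) + (∑ j, vb j ^ 2)) / 2) ^ p}
      = (1 / 2) * (∑ k, R k ^ 2) +
        sInf {z : ℝ | ∃ τ : ℝ, 0 ≤ τ ∧ ∃ (u : Fin m → ℝ) (v : Fin n → ℝ),
          Real.sqrt (∑ i, u i ^ 2) = 1 ∧ Real.sqrt (∑ j, v j ^ 2) = 1 ∧
          z = -(τ ^ (2 : ℕ)) * (∑ i, ∑ j, Aad R i j * vecMulVec u v i j) +
              (1 / 2) * τ ^ (4 : ℕ) * (∑ k, A (vecMulVec u v) k ^ 2) +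
              lam * τ ^ (2 * p)} := by
  have hlow : ∀ (ub : Fin m → ℝ) (vb : Fin n → ℝ),
      0 ≤ lam * (((∑ i, ub i ^ 2) + (∑ j, vb j ^ 2)) / 2) ^ p := fun ub vb => by positivity
  have hpow : ∀ τ : ℝ, 0 ≤ τ → τ ^ (2 * p) = (τ ^ 2) ^ p := fun τ hτ => by
    rw [Real.rpow_mul hτ, Real.rpow_two]
  by_cases hmn : m = 0 ∨ n = 0
  · have hvec : ∀ (ub : Fin m → ℝ) (vb : Fin n → ℝ), vecMulVec ub vb = 0 := fun ub vb => by
      ext i j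
      rcases hmn with rfl | rfl
      · exact i.elim0
      · exact j.elim0
    have hempty : {z : ℝ | ∃ τ : ℝ, 0 ≤ τ ∧ ∃ (u : Fin m → ℝ) (v : Fin n → ℝ),
          Real.sqrt (∑ i, u i ^ 2) = 1 ∧ Real.sqrt (∑ j, v j ^ 2) = 1 ∧
          z = -(τ ^ (2 : ℕ)) * (∑ i, ∑ j, Aad R i j * vecMulVec u v i j) +
              (1 / 2) * τ ^ (4 : ℕ) * (∑ k, A (vecMulVec u v) k ^ 2) +
              lam * τ ^ (2 * p)} = ∅ := by
      rw [Set.eq_empty_iff_forall_notMem]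
      rintro z ⟨τ, -, u, v, hu, hv, -⟩
      rcases hmn with rfl | rfl
      · simp at hu
      · simp at hv
    rw [hempty, Real.sInf_empty, add_zero]
    refine IsLeast.csInf_eq ⟨⟨0, 0, ?_⟩, ?_⟩
    · simp [Real.zero_rpow hp0.ne']
    · rintro z ⟨ub, vb, rfl⟩
      simpa [hvec] using hlow ub vb
  · push Not at hmn
    have : NeZero m := ⟨hmn.1⟩
    have : NeZero n := ⟨hmn.2⟩
    apply sInf_eq_add_sInf
    · refine ⟨0, ?_⟩
      rintro z ⟨ub, vb, rfl⟩
      have := hlow ub vb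
      positivity
    · obtain ⟨-, u, -, hu, -⟩ := exists_eq_smul_unit (0 : Fin m → ℝ)
      obtain ⟨-, v, -, hv, -⟩ := exists_eq_smul_unit (0 : Fin n → ℝ)
      exact ⟨_, 0, le_rfl, u, v, by rw [hu, Real.sqrt_one], by rw [hv, Real.sqrt_one], rfl⟩
    · rintro t ⟨τ, hτ, u, v, hu, hv, rfl⟩
      rw [Real.sqrt_eq_one] at hu hv
      refine ⟨τ • u, τ • v, ?_⟩
      rw [half_sum_sub_sq_rank_one A Aad hadj, sum_sq_smul, sum_sq_smul, hu, hv, hpow τ hτ,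
        mul_one, add_self_div_two]
      ring
    · rintro s ⟨ub, vb, rfl⟩
      obtain ⟨a, u, ha, hu, rfl⟩ := exists_eq_smul_unit ub
      obtain ⟨b, v, hb, hv, rfl⟩ := exists_eq_smul_unit vb
      have hab : 0 ≤ a * b := mul_nonneg ha hb
      have hle : (a * b) ^ p ≤ ((a ^ 2 + b ^ 2) / 2) ^ p :=
        Real.rpow_le_rpow hab (by nlinarith [sq_nonneg (a - b)]) hp0.le
      refine ⟨_, ⟨√(a * b), Real.sqrt_nonneg _, u, v, by rw [hu, Real.sqrt_one],
        by rw [hv, Real.sqrt_one], rfl⟩, ?_⟩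
      have h4 : √(a * b) ^ 4 = (a * b) ^ 2 := by
        rw [show (4 : ℕ) = 2 * 2 from rfl, pow_mul, Real.sq_sqrt hab]
      rw [half_sum_sub_sq_rank_one A Aad hadj, sum_sq_smul, sum_sq_smul, hu, hv,
        hpow _ (Real.sqrt_nonneg _), h4, Real.sq_sqrt hab, mul_one, mul_one]
      linarith [mul_le_mul_of_nonneg_left hle hlam.le]
end
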